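/- For any finite isolate-free simple graphs G and H, the semi-total domination number of the Cartesian product G □ H satisfies 3 · γ_{t2}(G □ H) ≥ γ_{t2}(G) · γ_{t2}(H). -/

import Mathlib

open SimpleGraph

/-- `S` is a semi-total dominating set of `G`: every vertex lies in the closed
neighborhood of `S`, and every vertex of `S` is within distance at most 2 of
another vertex of `S`. -/
def IsSemitotalDomSet {V : Type*} (G : SimpleGraph V) (S : Set V) : Prop :=
  (∀ v : V, v ∈ S ∨ ∃ u ∈ S, G.Adj u v) ∧
  (∀ u ∈ S, ∃ w ∈ S, w ≠ u ∧ (G.Adj u w ∨ ∃ z, G.Adj u z ∧ G.Adj z w))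

/-- The semi-total domination number of `G`. -/
noncomputable def semitotalDomNum {V : Type*} (G : SimpleGraph V) : ℕ :=
  sInf {n | ∃ S : Set V, IsSemitotalDomSet G S ∧ S.ncard = n}

open Finset in
/-- The three-fold bound in the `H` direction for one cell. -/
theorem aux_H {β : Type*} [Fintype β] (H : SimpleGraph β)
    (hH : ∀ v : β, ∃ u : β, H.Adj v u) (l : ℕ)
    (hl : ∀ T : Finset β, IsSemitotalDomSet H (T : Set β) → l ≤ T.card)
    (P J C : Finset β) (hJ : J ⊆ P)
    (hP : ∀ w ∈ P, w ∈ J ∨ ∃ w' ∈ P, w' ≠ w ∧ ∃ v, H.Adj w v ∧ H.Adj v w')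
    (hC : ∀ v, v ∈ C ↔ (v ∉ P ∧ ∀ w ∈ P, ¬ H.Adj w v)) :
    l ≤ P.card + C.card + J.card := by
  classical
  choose f hf using hH
  have hle : ((P ∪ C) ∪ J.image f).card ≤ P.card + C.card + J.card := by
    refine (card_union_le _ _).trans ?_
    exact Nat.add_le_add (card_union_le _ _) card_image_le
  refine (hl _ ?_).trans hle
  constructor
  · intro v
    by_cases hv : v ∈ C
    · left; simp [hv]
    · rw [hC] at hv
      by_cases hvP : v ∈ P
      · left; simp [hvP]
      · right
        have : ∃ w ∈ P, H.Adj w v := by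
          by_contra hcon
          push Not at hcon
          exact hv ⟨hvP, hcon⟩
        obtain ⟨w, hw, hwv⟩ := this
        exact ⟨w, by simp [hw], hwv⟩
  · intro w hw
    have hw' : (w ∈ P ∨ w ∈ C) ∨ ∃ a ∈ J, f a = w := by simpa [or_assoc] using hw
    rcases hw' with (hwP | hwC) | ⟨a, ha, rfl⟩
    · rcases hP w hwP with h | ⟨w', h1, h2, h3⟩
      · refine ⟨f w, ?_, (hf w).ne', Or.inl (hf w)⟩
        simp only [coe_union, coe_image, Set.mem_union]
        exact Or.inr ⟨w, h, rfl⟩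
      · exact ⟨w', by simp [h1], h2, Or.inr h3⟩
    · have hwC' := (hC w).1 hwC
      by_cases hc : f w ∈ C
      · exact ⟨f w, by simp [hc], (hf w).ne', Or.inl (hf w)⟩
      · rw [hC] at hc
        have hnP : f w ∉ P := fun h => hwC'.2 _ h (hf w).symm
        have : ∃ z ∈ P, H.Adj z (f w) := by
          by_contra hcon
          push Not at hcon
          exact hc ⟨hnP, hcon⟩
        obtain ⟨z, hz, hzw⟩ := this
        refine ⟨z, by simp [hz], ?_, Or.inr ⟨f w, hf w, hzw.symm⟩⟩
        rintro rfl
        exact hwC'.1 hz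
    · exact ⟨a, by simp [hJ ha], (hf a).ne, Or.inl (hf a).symm⟩

open Finset in
/-- The exchange argument in the `G` direction. -/
theorem aux_G {α : Type*} [Fintype α] [DecidableEq α] (G : SimpleGraph α)
    (hG : ∀ v : α, ∃ u : α, G.Adj v u) (U : Finset α)
    (hmin : ∀ T : Finset α, IsSemitotalDomSet G (T : Set α) → U.card ≤ T.card)
    (p : α → α) (hpU : ∀ a, p a ∈ U) (hp : ∀ a, p a = a ∨ G.Adj (p a) a)
    (S F : Finset α) (hS : S ⊆ U)
    (hdom : ∀ a, p a ∈ S → ∃ y ∈ F, y = a ∨ G.Adj y a)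
    (hF : ∀ a ∈ F, p a ∉ S)
    (hbad : ∀ r ∈ U, r ∉ S → r ∈ F ∨ ∃ t, (t ∈ U ∧ t ∉ S ∨ t ∈ F) ∧ t ≠ r ∧
      (G.Adj r t ∨ ∃ z, G.Adj r z ∧ G.Adj z t)) :
    S.card ≤ F.card := by
  choose f hf using hG
  have hle : (((U \ S) ∪ F) ∪ ((U \ S) ∩ F).image f).card ≤ (U \ S).card + F.card := by
    refine (card_union_le _ _).trans ?_
    rw [← card_union_add_card_inter (U \ S) F]
    exact Nat.add_le_add_left card_image_le _
  have hsd := card_sdiff_add_card_eq_card hS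
  suffices h : U.card ≤ (((U \ S) ∪ F) ∪ ((U \ S) ∩ F).image f).card by omega
  apply hmin
  constructor
  · intro a
    by_cases ha : p a ∈ S
    · obtain ⟨y, hy, hya⟩ := hdom a ha
      rcases hya with rfl | hya
      · left; simp [hy]
      · right; exact ⟨y, by simp [hy], hya⟩
    · rcases hp a with h | h
      · left; rw [← h]; simp [hpU a, ha]
      · right; exact ⟨p a, by simp [hpU a, ha], h⟩
  · intro w hw
    have key : ∀ r, r ∈ U → r ∉ S → r ∈ F →
        f r ∈ (((((U \ S) ∪ F) ∪ ((U \ S) ∩ F).image f) : Finset α) : Set α) := by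
      intro r h1 h2 h3
      rw [mem_coe, mem_union]
      right
      exact mem_image_of_mem f (by simp [h1, h2, h3])
    have hw' : ((w ∈ U ∧ w ∉ S) ∨ w ∈ F) ∨ ∃ a, ((a ∈ U ∧ a ∉ S) ∧ a ∈ F) ∧ f a = w := by
      rw [mem_coe, mem_union, mem_union, mem_sdiff, mem_image] at hw
      simpa only [mem_inter, mem_sdiff] using hw
    rcases hw' with (⟨hwU, hwS⟩ | hwF) | ⟨a, ⟨⟨haU, haS⟩, haF⟩, rfl⟩
    · rcases hbad w hwU hwS with h | ⟨t, ht, h2, h3⟩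
      · exact ⟨f w, key w hwU hwS h, (hf w).ne', Or.inl (hf w)⟩
      · refine ⟨t, ?_, h2, h3⟩
        rw [mem_coe, mem_union, mem_union, mem_sdiff]
        exact Or.inl ht
    · have hpS := hF w hwF
      rcases hp w with h | h
      · have hwU : w ∈ U := h ▸ hpU w
        have hwS : w ∉ S := h ▸ hpS
        exact ⟨f w, key w hwU hwS hwF, (hf w).ne', Or.inl (hf w)⟩
      · exact ⟨p w, by simp [hpU w, hpS], h.ne, Or.inl h.symm⟩
    · exact ⟨a, by simp [haF], (hf a).ne, Or.inl (hf a).symm⟩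

open Finset in
/-- The counting argument inside one cell `E`, with two distinguished rows `u ≠ x`. -/
theorem aux_count {α β : Type*} [DecidableEq α] [DecidableEq β]
    (E : Finset (α × β)) (u x : α) (near : β → β → Prop)
    (P I A B : Finset β) (hP : P = E.image Prod.snd)
    (hI : ∀ w ∈ I, w ∈ P ∧ ∀ w' ∈ P, w' ≠ w → ¬ near w w')
    (hA : ∀ w, w ∈ A → x ≠ u ∧ (u, w) ∈ E ∧ ∃ w', near w w' ∧ (x, w') ∈ E)
    (hB : ∀ w, w ∈ B → x ≠ u ∧ (x, w) ∈ E ∧ ∃ w', near w w' ∧ (u, w') ∈ E) :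
    P.card + I.card + A.card + B.card ≤ 2 * E.card := by
  have mP : ∀ a w, (a, w) ∈ E → w ∈ P := by
    intro a w h; rw [hP]; exact mem_image_of_mem Prod.snd h
  have cE : E.card = ∑ w ∈ P, (E.filter (fun e => e.2 = w)).card :=
    card_eq_sum_card_fiberwise (fun e he => mP e.1 e.2 he)
  have cs : ∀ X : Finset β, X ⊆ P → X.card = ∑ w ∈ P, if w ∈ X then 1 else 0 := by
    intro X hX
    rw [← sum_filter, sum_const, smul_eq_mul, mul_one, filter_mem_eq_inter,
      inter_eq_right.2 hX]
  rw [cE, cs I (fun w hw => (hI w hw).1), cs A (fun w hw => mP _ _ (hA w hw).2.1),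
    cs B (fun w hw => mP _ _ (hB w hw).2.1), card_eq_sum_ones, ← sum_add_distrib,
    ← sum_add_distrib, ← sum_add_distrib, mul_sum]
  refine sum_le_sum fun w hw => ?_
  have h1 : 1 ≤ (E.filter (fun e => e.2 = w)).card := by
    rw [hP] at hw
    obtain ⟨e, he, rfl⟩ := mem_image.1 hw
    exact card_pos.2 ⟨e, by simp [he]⟩
  have h2 : x ≠ u → (u, w) ∈ E → (x, w) ∈ E → 2 ≤ (E.filter (fun e => e.2 = w)).card := by
    intro hne hu hx
    have : ({(u, w), (x, w)} : Finset (α × β)) ⊆ E.filter (fun e => e.2 = w) := by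
      intro e he
      simp only [mem_insert, mem_singleton] at he
      rcases he with rfl | rfl <;> simp [hu, hx]
    have h3 := card_le_card this
    rwa [card_pair (by simp [hne.symm])] at h3
  by_cases hboth : (u, w) ∈ E ∧ (x, w) ∈ E ∧ x ≠ u
  · have := h2 hboth.2.2 hboth.1 hboth.2.1
    split_ifs <;> omega
  · by_cases hwA : w ∈ A
    · obtain ⟨a1, a2, w', a3, a4⟩ := hA w hwA
      have hwB : w ∉ B := fun h => hboth ⟨a2, (hB w h).2.1, a1⟩
      have hne : w' ≠ w := by rintro rfl; exact hboth ⟨a2, a4, a1⟩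
      have hwI : w ∉ I := fun h => (hI w h).2 w' (mP _ _ a4) hne a3
      simp only [hwA, hwB, hwI, if_true, if_false]
      omega
    · by_cases hwB : w ∈ B
      · obtain ⟨a1, a2, w', a3, a4⟩ := hB w hwB
        have hne : w' ≠ w := by rintro rfl; exact hboth ⟨a4, a2, a1⟩
        have hwI : w ∉ I := fun h => (hI w h).2 w' (mP _ _ a4) hne a3
        simp only [hwA, hwB, hwI, if_true, if_false]
        omega
      · simp only [hwA, hwB, if_false]
        split_ifs <;> omega

open Finset in
theorem aux_core {α β : Type*} [Fintype α] [Fintype β]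
    (G : SimpleGraph α) (H : SimpleGraph β)
    (hG : ∀ v : α, ∃ u : α, G.Adj v u) (hH : ∀ v : β, ∃ u : β, H.Adj v u)
    (U : Finset α) (hU : IsSemitotalDomSet G (U : Set α))
    (hmin : ∀ T : Finset α, IsSemitotalDomSet G (T : Set α) → U.card ≤ T.card)
    (l : ℕ) (hl : ∀ T : Finset β, IsSemitotalDomSet H (T : Set β) → l ≤ T.card)
    (D : Finset (α × β))
    (hD : ∀ a b, (a, b) ∈ D ∨ (∃ a', G.Adj a' a ∧ (a', b) ∈ D) ∨
      ∃ b', H.Adj b' b ∧ (a, b') ∈ D) :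
    U.card * l ≤ 3 * D.card := by
  classical
  -- the partition
  have hp0 : ∀ a, ∃ u, u ∈ U ∧ (u = a ∨ G.Adj u a) ∧ (a ∈ U → u = a) := by
    intro a
    by_cases ha : a ∈ U
    · exact ⟨a, ha, Or.inl rfl, fun _ => rfl⟩
    · rcases hU.1 a with h | ⟨u, hu, hua⟩
      · exact absurd h ha
      · exact ⟨u, hu, Or.inr hua, fun h => absurd h ha⟩
  choose p hpU hpa hpid using hp0
  -- partners
  have hj0 : ∀ u, ∃ w x, u ∈ U → w ∈ U ∧ w ≠ u ∧
      (G.Adj u w ∨ (G.Adj u x ∧ G.Adj x w)) := by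
    intro u
    by_cases hu : u ∈ U
    · obtain ⟨w, h1, h2, h3⟩ := hU.2 u hu
      rcases h3 with h3 | ⟨z, h3⟩
      · exact ⟨w, u, fun _ => ⟨h1, h2, Or.inl h3⟩⟩
      · exact ⟨w, z, fun _ => ⟨h1, h2, Or.inr h3⟩⟩
    · exact ⟨u, u, fun h => absurd h hu⟩
  choose j x hjx using hj0
  let near : β → β → Prop := fun w w' => ∃ v, H.Adj w v ∧ H.Adj v w'
  let E : α → Finset (α × β) := fun u => D.filter (fun e => p e.1 = u)
  let P : α → Finset β := fun u => (E u).image Prod.snd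
  let I : α → Finset β := fun u => (P u).filter (fun w => ∀ w' ∈ P u, w' ≠ w → ¬ near w w')
  let A : α → Finset β := fun u => univ.filter (fun w => x u ≠ u ∧ (u, w) ∈ E u ∧
    ∃ w', near w w' ∧ (x u, w') ∈ E u)
  let B : α → Finset β := fun u => univ.filter (fun w => x u ≠ u ∧ (x u, w) ∈ E u ∧
    ∃ w', near w w' ∧ (u, w') ∈ E u)
  let W : α → Finset β := fun u => if (A u).card ≤ (B u).card then A u else B u
  let Q : α → Finset β := fun i => (U.filter (fun r => j r = i)).biUnion W
  let C : α → Finset β := fun i =>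
    univ.filter (fun v => v ∉ P i ∪ Q i ∧ ∀ w ∈ P i ∪ Q i, ¬ H.Adj w v)
  have memP : ∀ a w, (a, w) ∈ D → w ∈ P (p a) := by
    intro a w h
    exact mem_image.2 ⟨(a, w), by simp [E, h], rfl⟩
  have hcell : ∀ u, (P u).card + (I u).card + 2 * (W u).card ≤ 2 * (E u).card := by
    intro u
    have h := aux_count (E u) u (x u) near (P u) (I u) (A u) (B u) rfl
      (fun w hw => by simpa [I] using hw)
      (fun w hw => by simpa only [A, mem_filter, mem_univ, true_and] using hw)
      (fun w hw => by simpa only [B, mem_filter, mem_univ, true_and] using hw)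
    have hW : 2 * (W u).card ≤ (A u).card + (B u).card := by
      by_cases hc : (A u).card ≤ (B u).card
      · have : W u = A u := if_pos hc
        rw [this]; omega
      · have : W u = B u := if_neg hc
        rw [this]; omega
    omega
  have hrow : ∀ u, l ≤ (P u).card + (I u).card + 2 * (Q u).card + (C u).card := by
    intro u
    have h := aux_H H hH l hl (P u ∪ Q u) (I u ∪ Q u) (C u)
      (union_subset_union (filter_subset _ _) subset_rfl)
      (by
        intro w hw
        by_cases hwQ : w ∈ Q u
        · left; simp [hwQ]
        · have hwP : w ∈ P u := by
            rcases mem_union.1 hw with h | h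
            · exact h
            · exact absurd h hwQ
          by_cases hwI : w ∈ I u
          · left; exact mem_union_left _ hwI
          · right
            have : ∃ w' ∈ P u, w' ≠ w ∧ near w w' := by
              by_contra hcon
              push Not at hcon
              exact hwI (mem_filter.2 ⟨hwP, hcon⟩)
            obtain ⟨w', h1, h2, h3⟩ := this
            exact ⟨w', mem_union_left _ h1, h2, h3⟩)
      (fun v => by simp only [C, mem_filter, mem_univ, true_and])
    have h1 := card_union_le (P u) (Q u)
    have h2 := card_union_le (I u) (Q u)
    omega
  have hcol : ∀ v, (U.filter (fun u => v ∈ C u)).card ≤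
      (univ.filter (fun a => (a, v) ∈ D)).card := by
    intro v
    have hC : ∀ u, v ∈ C u ↔ v ∉ P u ∪ Q u ∧ ∀ w ∈ P u ∪ Q u, ¬ H.Adj w v := by
      intro u; simp only [C, mem_filter, mem_univ, true_and]
    have hdom : ∀ a, v ∈ C (p a) → ∃ y, (y, v) ∈ D ∧ (y = a ∨ G.Adj y a) := by
      intro a ha
      rw [hC] at ha
      rcases hD a v with h | ⟨a', h1, h2⟩ | ⟨b', h1, h2⟩
      · exact ⟨a, h, Or.inl rfl⟩
      · exact ⟨a', h2, Or.inr h1⟩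
      · exact absurd h1 (ha.2 b' (mem_union_left _ (memP _ _ h2)))
    refine aux_G G hG U hmin p hpU hpa _ _ ?_ ?_ ?_ ?_
    · exact filter_subset _ _
    · intro a ha
      obtain ⟨y, h1, h2⟩ := hdom a (mem_filter.1 ha).2
      exact ⟨y, by simp [h1], h2⟩
    · intro a ha hc
      have ha' : (a, v) ∈ D := by simpa using ha
      exact ((hC _).1 (mem_filter.1 hc).2).1 (mem_union_left _ (memP _ _ ha'))
    · intro r hr hrS
      have hrC : v ∉ C r := fun h => hrS (mem_filter.2 ⟨hr, h⟩)
      by_cases hrF : (r, v) ∈ D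
      · left; simp [hrF]
      right
      -- it suffices to find a good vertex
      have fin : ∀ t, (t ∈ U ∧ v ∉ C t ∨ (t, v) ∈ D) → t ≠ r →
          (G.Adj r t ∨ ∃ z, G.Adj r z ∧ G.Adj z t) →
          ∃ t, (t ∈ U ∧ t ∉ U.filter (fun u => v ∈ C u) ∨
            t ∈ univ.filter (fun a => (a, v) ∈ D)) ∧ t ≠ r ∧
            (G.Adj r t ∨ ∃ z, G.Adj r z ∧ G.Adj z t) := by
        intro t h1 h2 h3
        refine ⟨t, ?_, h2, h3⟩
        rcases h1 with ⟨h1, h1'⟩ | h1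
        · exact Or.inl ⟨h1, fun h => h1' (mem_filter.1 h).2⟩
        · exact Or.inr (by simp [h1])
      -- any horizontal dominator of a neighbour of `r` is good
      have fin2 : ∀ z y, G.Adj r z → (y, v) ∈ D → (y = z ∨ G.Adj y z) →
          ∃ t, (t ∈ U ∧ t ∉ U.filter (fun u => v ∈ C u) ∨
            t ∈ univ.filter (fun a => (a, v) ∈ D)) ∧ t ≠ r ∧
            (G.Adj r t ∨ ∃ z, G.Adj r z ∧ G.Adj z t) := by
        intro z y hz hy hyz
        have hne : y ≠ r := by rintro rfl; exact hrF hy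
        rcases hyz with rfl | hyz
        · exact fin y (Or.inr hy) hne (Or.inl hz)
        · exact fin y (Or.inr hy) hne (Or.inr ⟨z, hz, hyz.symm⟩)
      obtain ⟨hjU, hjne, hcase⟩ := hjx r hr
      by_cases hjC : v ∈ C (j r)
      swap
      · refine fin (j r) (Or.inl ⟨hjU, hjC⟩) hjne ?_
        rcases hcase with h | h
        · exact Or.inl h
        · exact Or.inr ⟨_, h⟩
      rcases hcase with hadj | ⟨hx1, hx2⟩
      · obtain ⟨y, h1, h2⟩ := hdom (j r) (by rwa [hpid _ hjU])
        exact fin2 _ y hadj h1 h2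
      by_cases hlC : v ∈ C (p (x r))
      · obtain ⟨y, h1, h2⟩ := hdom (x r) hlC
        exact fin2 _ y hx1 h1 h2
      by_cases hlr : p (x r) = r
      swap
      · refine fin (p (x r)) (Or.inl ⟨hpU _, hlC⟩) hlr ?_
        rcases hpa (x r) with h | h
        · left; rw [h]; exact hx1
        · right; exact ⟨x r, hx1, h.symm⟩
      rcases hD (x r) v with h | ⟨a', h1, h2⟩ | ⟨w, hwv, hw⟩
      · exact fin2 _ _ hx1 h (Or.inl rfl)
      · exact fin2 _ _ hx1 h2 (Or.inr h1)
      rcases hD r v with h | ⟨a', h1, h2⟩ | ⟨w', hwv', hw'⟩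
      · exact absurd h hrF
      · exact fin a' (Or.inr h2) h1.ne (Or.inl h1.symm)
      exfalso
      have hCj := (hC _).1 hjC
      have hEx : (x r, w) ∈ E r := by simp [E, hw, hlr]
      have hEr : (r, w') ∈ E r := by simp [E, hw', hpid r hr]
      have hA : w' ∈ A r := by
        simp only [A, mem_filter, mem_univ, true_and]
        exact ⟨hx1.ne', hEr, w, ⟨v, hwv', hwv.symm⟩, hEx⟩
      have hB : w ∈ B r := by
        simp only [B, mem_filter, mem_univ, true_and]
        exact ⟨hx1.ne', hEx, w', ⟨v, hwv, hwv'.symm⟩, hEr⟩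
      have hWQ : W r ⊆ Q (j r) := by
        intro t ht
        exact mem_biUnion.2 ⟨r, mem_filter.2 ⟨hr, rfl⟩, ht⟩
      by_cases hc : (A r).card ≤ (B r).card
      · have : W r = A r := if_pos hc
        exact hCj.2 w' (mem_union_right _ (hWQ (this ▸ hA))) hwv'
      · have : W r = B r := if_neg hc
        exact hCj.2 w (mem_union_right _ (hWQ (this ▸ hB))) hwv
  -- summation
  have s1 : ∑ u ∈ U, (E u).card = D.card :=
    (card_eq_sum_card_fiberwise (f := fun e : α × β => p e.1) (fun e _ => hpU e.1)).symm
  have s2 : ∑ u ∈ U, (Q u).card ≤ ∑ u ∈ U, (W u).card := by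
    rw [← sum_fiberwise_of_maps_to (s := U) (t := U) (g := j) (fun r hr => (hjx r hr).1)
      (fun r => (W r).card)]
    exact sum_le_sum fun u _ => card_biUnion_le
  have s3 : ∑ u ∈ U, (C u).card = ∑ v : β, (U.filter (fun u => v ∈ C u)).card := by
    have := sum_card_bipartiteAbove_eq_sum_card_bipartiteBelow (s := U) (t := (univ : Finset β))
      (fun u v => v ∈ C u)
    simpa [bipartiteAbove, bipartiteBelow] using this
  have s4 : ∑ v : β, (univ.filter (fun a => (a, v) ∈ D)).card = D.card := by
    rw [card_eq_sum_card_fiberwise (f := Prod.snd) (s := D) (t := univ) (fun _ _ => by simp)]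
    refine sum_congr rfl fun v _ => ?_
    refine card_bij (fun a _ => (a, v)) ?_ ?_ ?_
    · intro a ha; simpa using ha
    · intro a _ b _ h; exact (Prod.mk.inj h).1
    · rintro ⟨a, b⟩ hb
      obtain ⟨h1, h2⟩ := mem_filter.1 hb
      have h3 : b = v := h2
      subst h3
      exact ⟨a, by simpa using h1, rfl⟩
  have t1 := sum_le_sum (s := U) fun u _ => hrow u
  have t2 := sum_le_sum (s := U) fun u _ => hcell u
  have t3 := sum_le_sum (s := (univ : Finset β)) fun v _ => hcol v
  simp only [sum_add_distrib, ← mul_sum, sum_const, smul_eq_mul] at t1 t2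
  rw [← s3, s4] at t3
  rw [s1] at t2
  omega

/-- A minimum semi-total dominating set exists. -/
theorem aux_min {α : Type*} [Fintype α] (G : SimpleGraph α)
    (hG : ∀ v : α, ∃ u : α, G.Adj v u) :
    ∃ U : Finset α, IsSemitotalDomSet G (U : Set α) ∧ U.card = semitotalDomNum G := by
  classical
  have hne : {n | ∃ S : Set α, IsSemitotalDomSet G S ∧ S.ncard = n}.Nonempty := by
    refine ⟨_, Set.univ, ⟨fun v => Or.inl trivial, fun u _ => ?_⟩, rfl⟩
    obtain ⟨w, hw⟩ := hG u
    exact ⟨w, trivial, hw.ne', Or.inl hw⟩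
  obtain ⟨S, h1, h2⟩ := Nat.sInf_mem hne
  refine ⟨S.toFinset, by simpa using h1, ?_⟩
  rw [← Set.ncard_eq_toFinset_card']
  exact h2

theorem aux_le {α : Type*} (G : SimpleGraph α) (T : Finset α)
    (hT : IsSemitotalDomSet G (T : Set α)) : semitotalDomNum G ≤ T.card :=
  Nat.sInf_le ⟨T, hT, Set.ncard_coe_finset T⟩

theorem three_mul_semitotalDomNum_boxProd_ge
    {α β : Type*} [Fintype α] [Fintype β]
    (G : SimpleGraph α) (H : SimpleGraph β)
    (hG : ∀ v : α, ∃ u : α, G.Adj v u) (hH : ∀ v : β, ∃ u : β, H.Adj v u) :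
    3 * semitotalDomNum (G □ H) ≥ semitotalDomNum G * semitotalDomNum H := by
  obtain ⟨U, hU, hUc⟩ := aux_min G hG
  obtain ⟨D, hD, hDc⟩ := aux_min (G □ H) (by
    rintro ⟨a, b⟩
    obtain ⟨a', ha⟩ := hG a
    exact ⟨(a', b), by simp [SimpleGraph.boxProd_adj, ha]⟩)
  rw [← hDc, ← hUc]
  refine aux_core G H hG hH U hU (fun T hT => hUc ▸ aux_le G T hT) _
    (fun T hT => aux_le H T hT) D ?_
  intro a b
  rcases hD.1 (a, b) with h | ⟨⟨a', b'⟩, h1, h2⟩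
  · exact Or.inl h
  · rw [SimpleGraph.boxProd_adj] at h2
    rcases h2 with ⟨h2, h3⟩ | ⟨h2, h3⟩
    · have h3' : b' = b := h3
      subst h3'
      exact Or.inr (Or.inl ⟨a', h2, h1⟩)
    · have h3' : a' = a := h3
      subst h3'
      exact Or.inr (Or.inr ⟨b', h2, h1⟩)
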